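/- For every ε > 0 and every prime q, there exist a positive integer k and a mixing matrix M ∈ 𝔽_q^{k×k} such that M satisfies (1-ε, k^{1-ε})-exponential polarization. -/

import Mathlib

open scoped BigOperators

/- Probability of an event under a probability mass function on a finite type. -/
open Classical in
noncomputable def pmfProb {Ω : Type} [Fintype Ω] (μ : Ω → ℝ) (S : Set Ω) : ℝ :=
  ∑ ω : Ω, if ω ∈ S then μ ω else 0

/- Conditional Shannon entropy (base 2) `H(X|Y)` of finitely-valued random variables
on a finite probability space given by the mass function `μ`. -/
open Classical in
noncomputable def condEnt {Ω S T : Type} [Fintype Ω] [Fintype S] [Fintype T]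
    (μ : Ω → ℝ) (X : Ω → S) (Y : Ω → T) : ℝ :=
  ∑ s : S, ∑ t : T,
    (if pmfProb μ {ω | X ω = s ∧ Y ω = t} = 0 then 0
     else -(pmfProb μ {ω | X ω = s ∧ Y ω = t}) *
        Real.logb 2 (pmfProb μ {ω | X ω = s ∧ Y ω = t} / pmfProb μ {ω | Y ω = t}))

/- Normalized conditional entropy `H̄(X|Y) = H(X|Y)/log₂ q` for `X` valued in `𝔽_q`. -/
noncomputable def nCondEnt (q : ℕ) [NeZero q] {Ω T : Type} [Fintype Ω] [Fintype T]
    (μ : Ω → ℝ) (X : Ω → ZMod q) (Y : Ω → T) : ℝ :=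
  condEnt μ X Y / Real.logb 2 q

/- A matrix `M ∈ 𝔽_q^{k×k}` satisfies `(η, b)`-exponential polarization. -/
open Classical in
noncomputable def ExpPolar (q : ℕ) [NeZero q] (k : ℕ)
    (M : Matrix (Fin k) (Fin k) (ZMod q)) (η b : ℝ) : Prop :=
  ∃ τ : ℝ, 0 < τ ∧ ∀ δ : ℝ, 0 ≤ δ → δ < τ →
    ∀ (Ω Alph : Type) [Fintype Ω] [Fintype Alph] (μ : Ω → ℝ),
      (∀ ω, 0 ≤ μ ω) → (∑ ω : Ω, μ ω = 1) →
      ∀ (U : Fin k → Ω → ZMod q) (A : Fin k → Ω → Alph),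
      -- the pairs (U_i, A_i) are i.i.d. with common marginal p
      (∃ p : ZMod q × Alph → ℝ,
        (∀ (i : Fin k) (u : ZMod q) (a : Alph),
            pmfProb μ {ω | U i ω = u ∧ A i ω = a} = p (u, a)) ∧
        (∀ (u : Fin k → ZMod q) (a : Fin k → Alph),
            pmfProb μ {ω | ∀ i, U i ω = u i ∧ A i ω = a i} = ∏ i, p (u i, a i))) →
      (∀ i : Fin k, nCondEnt q μ (U i) (A i) ≤ δ) →
      η * k ≤ ((Finset.univ : Finset (Fin k)).filter (fun j : Fin k =>
        nCondEnt q μ (fun ω => Matrix.vecMul (fun i => U i ω) M j)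
          (fun ω => ((fun i : Fin (j : ℕ) =>
              Matrix.vecMul (fun i' => U i' ω) M (Fin.castLE j.isLt.le i)),
            (fun i => A i ω))) ≤ δ ^ b)).card

/- A matrix is mixing if it is invertible and no row permutation of it is upper triangular. -/
def IsMixing {q k : ℕ} (M : Matrix (Fin k) (Fin k) (ZMod q)) : Prop :=
  IsUnit M.det ∧ ∀ σ : Equiv.Perm (Fin k), ¬ (∀ i j : Fin k, j < i → M (σ i) j = 0)

/- The Kronecker square `M ⊗ M`, with the standard (lexicographic) indexing by `Fin (k*k)`. -/
noncomputable def kron2 {q k : ℕ} (M : Matrix (Fin k) (Fin k) (ZMod q)) :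
    Matrix (Fin (k * k)) (Fin (k * k)) (ZMod q) :=
  Matrix.reindex finProdFinEquiv finProdFinEquiv (Matrix.kroneckerMap (· * ·) M M)

open Classical in
theorem pmfProb_comp {Ω S : Type} [Fintype Ω] [Fintype S] (μ : Ω → ℝ) (Z : Ω → S)
    (P : S → Prop) :
    pmfProb μ {ω | P (Z ω)} = ∑ z, if P z then pmfProb μ {ω | Z ω = z} else 0 := by
  have h (z : S) : (if P z then pmfProb μ {ω | Z ω = z} else 0)
      = ∑ ω, if Z ω = z then (if P (Z ω) then μ ω else 0) else 0 := by
    by_cases hz : P z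
    · simp only [pmfProb, hz, if_true, Set.mem_ofPred_eq]
      refine Finset.sum_congr rfl fun ω _ => ?_
      by_cases h : Z ω = z <;> simp [h, hz]
    · rw [if_neg hz]
      refine (Finset.sum_eq_zero fun ω _ => ?_).symm
      by_cases h : Z ω = z <;> simp [h, hz]
  simp only [h]
  rw [Finset.sum_comm]
  simp [pmfProb]

theorem pmfProb_nonneg {Ω : Type} [Fintype Ω] {μ : Ω → ℝ} (hμ : ∀ ω, 0 ≤ μ ω) (E : Set Ω) :
    0 ≤ pmfProb μ E :=
  Finset.sum_nonneg fun ω _ => by split_ifs <;> simp [hμ]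

theorem pmfProb_mono {Ω : Type} [Fintype Ω] {μ : Ω → ℝ} (hμ : ∀ ω, 0 ≤ μ ω) {E F : Set Ω}
    (h : E ⊆ F) : pmfProb μ E ≤ pmfProb μ F := by
  refine Finset.sum_le_sum fun ω _ => ?_
  by_cases hE : ω ∈ E
  · simp [hE, h hE]
  · rw [if_neg hE]
    split_ifs <;> simp [hμ]

open Classical in
theorem pmfProb_biUnion_le {Ω ι : Type} [Fintype Ω] {μ : Ω → ℝ} (hμ : ∀ ω, 0 ≤ μ ω)
    (s : Finset ι) (E : ι → Set Ω) :
    pmfProb μ {ω | ∃ i ∈ s, ω ∈ E i} ≤ ∑ i ∈ s, pmfProb μ (E i) := by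
  unfold pmfProb
  rw [Finset.sum_comm]
  refine Finset.sum_le_sum fun ω _ => ?_
  have h0 : ∀ i ∈ s, 0 ≤ if ω ∈ E i then μ ω else 0 := fun i _ => by split_ifs <;> simp [hμ]
  split_ifs with h
  · obtain ⟨i, hi, hω⟩ := h
    simpa [hω] using Finset.single_le_sum h0 hi
  · exact Finset.sum_nonneg h0

open Classical in
theorem sum_pmfProb_and {Ω S T : Type} [Fintype Ω] [Fintype S] (μ : Ω → ℝ)
    (X : Ω → S) (Y : Ω → T) (t : T) :
    ∑ s, pmfProb μ {ω | X ω = s ∧ Y ω = t} = pmfProb μ {ω | Y ω = t} := by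
  unfold pmfProb
  rw [Finset.sum_comm]
  refine Finset.sum_congr rfl fun ω _ => ?_
  by_cases h : Y ω = t <;> simp [h]

open Classical in
theorem sum_pmfProb {Ω T : Type} [Fintype Ω] [Fintype T] (μ : Ω → ℝ) (Y : Ω → T) :
    ∑ t, pmfProb μ {ω | Y ω = t} = ∑ ω, μ ω := by
  unfold pmfProb
  rw [Finset.sum_comm]
  simp

open Classical in
theorem pmfProb_ne_eq {Ω S T : Type} [Fintype Ω] [Fintype S] [Fintype T] (μ : Ω → ℝ)
    (X : Ω → S) (Y : Ω → T) (g : T → S) :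
    pmfProb μ {ω | X ω ≠ g (Y ω)}
      = ∑ t, ∑ s, if s = g t then 0 else pmfProb μ {ω | X ω = s ∧ Y ω = t} := by
  have := pmfProb_comp μ (fun ω => (Y ω, X ω)) (fun z => z.2 ≠ g z.1)
  rw [this, Fintype.sum_prod_type]
  simp [and_comm]

theorem condEnt_mul_log_two {Ω S T : Type} [Fintype Ω] [Fintype S] [Fintype T]
    (μ : Ω → ℝ) (X : Ω → S) (Y : Ω → T) :
    condEnt μ X Y * Real.log 2 = ∑ t, ∑ s, -pmfProb μ {ω | X ω = s ∧ Y ω = t} *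
      Real.log (pmfProb μ {ω | X ω = s ∧ Y ω = t} / pmfProb μ {ω | Y ω = t}) := by
  have h2 : Real.log 2 ≠ 0 := (Real.log_pos one_lt_two).ne'
  unfold condEnt
  rw [Finset.sum_comm]
  simp only [Finset.sum_mul]
  refine Finset.sum_congr rfl fun t _ => Finset.sum_congr rfl fun s _ => ?_
  split_ifs with h
  · simp [h]
  · rw [Real.logb]
    field_simp

theorem pmfProb_and_le {Ω S T : Type} [Fintype Ω] {μ : Ω → ℝ} (hμ : ∀ ω, 0 ≤ μ ω)
    (X : Ω → S) (Y : Ω → T) (s : S) (t : T) :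
    pmfProb μ {ω | X ω = s ∧ Y ω = t} ≤ pmfProb μ {ω | Y ω = t} :=
  pmfProb_mono hμ fun _ h => h.2

/-- Maximum a posteriori prediction errs with probability at most the conditional entropy
in nats. -/
theorem exists_predictor {Ω S T : Type} [Fintype Ω] [Fintype S] [Nonempty S] [Fintype T]
    {μ : Ω → ℝ} (hμ : ∀ ω, 0 ≤ μ ω) (X : Ω → S) (Y : Ω → T) :
    ∃ g : T → S, pmfProb μ {ω | X ω ≠ g (Y ω)} ≤ condEnt μ X Y * Real.log 2 := by
  classical
  choose g hg using fun t : T =>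
    Finite.exists_max fun s : S => pmfProb μ {ω | X ω = s ∧ Y ω = t}
  refine ⟨g, ?_⟩
  rw [condEnt_mul_log_two, pmfProb_ne_eq]
  refine Finset.sum_le_sum fun t _ => ?_
  have hsum := sum_pmfProb_and μ X Y t
  set w : S → ℝ := fun s => pmfProb μ {ω | X ω = s ∧ Y ω = t} with hw
  set W := pmfProb μ {ω | Y ω = t} with hW
  change ∑ s, (if s = g t then 0 else w s) ≤ ∑ s, -w s * Real.log (w s / W)
  have hw0 : ∀ s, 0 ≤ w s := fun s => pmfProb_nonneg hμ _
  have hwg : ∀ s, w s ≤ w (g t) := hg t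
  have hwW : ∀ s, w s ≤ W := fun s => pmfProb_and_le hμ X Y s t
  have h1 : ∑ s, (if s = g t then 0 else w s) = W - w (g t) := by
    have : ∀ s, (if s = g t then 0 else w s) = w s - if s = g t then w s else 0 := by
      intro s; split_ifs <;> simp
    simp only [this, Finset.sum_sub_distrib]
    simp [hsum]
  rw [h1]
  have h2 : ∀ s, w s * (1 - w (g t) / W) ≤ -w s * Real.log (w s / W) := by
    intro s
    rcases (hw0 s).eq_or_lt with h | h
    · simp [← h]
    · have hWp : 0 < W := h.trans_le (hwW s)
      have hl := Real.log_le_sub_one_of_pos (div_pos h hWp)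
      have hd : w s / W ≤ w (g t) / W := by gcongr; exact hwg s
      nlinarith
  refine le_trans (le_of_eq ?_) (Finset.sum_le_sum fun s _ => h2 s)
  rw [← Finset.sum_mul, hsum]
  rcases eq_or_ne W 0 with h | h
  · have : w (g t) = 0 := le_antisymm (h ▸ hwW _) (hw0 _)
    simp [h, this]
  · field_simp

theorem neg_mul_log_div_le_sub {w W : ℝ} (hw : 0 ≤ w) (hwW : w ≤ W) :
    -w * Real.log (w / W) ≤ W - w := by
  rcases hw.eq_or_lt with h | h
  · simpa [← h] using hwW
  · have hl := Real.log_le_sub_one_of_pos (div_pos (h.trans_le hwW) h)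
    have he : Real.log (W / w) = -Real.log (w / W) := by rw [← Real.log_inv, inv_div]
    calc -w * Real.log (w / W) = w * Real.log (W / w) := by rw [he]; ring
      _ ≤ w * (W / w - 1) := by gcongr
      _ = W - w := by field_simp

theorem neg_mul_log_div_le_sqrt {w W : ℝ} (hw : 0 ≤ w) (hwW : w ≤ W) :
    -w * Real.log (w / W) ≤ 2 * (√w * √W) := by
  rcases hw.eq_or_lt with h | h
  · simp [← h]
  · have hW := h.trans_le hwW
    have hs : 0 < √w := Real.sqrt_pos.2 h
    have hS : 0 < √W := Real.sqrt_pos.2 hW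
    have hl := Real.log_le_sub_one_of_pos (div_pos hS hs)
    have he : Real.log (w / W) = -2 * Real.log (√W / √w) := by
      rw [Real.log_div h.ne' hW.ne', Real.log_div hS.ne' hs.ne', Real.log_sqrt hW.le,
        Real.log_sqrt h.le]
      ring
    calc -w * Real.log (w / W) = 2 * (w * Real.log (√W / √w)) := by rw [he]; ring
      _ ≤ 2 * (w * (√W / √w)) := by gcongr; linarith
      _ = 2 * (√w * √W) := by
        congr 1
        nth_rewrite 1 [← Real.mul_self_sqrt hw]
        field_simp

/-- A Fano-type inequality: a good predictor forces small conditional entropy. -/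
theorem condEnt_le_of_predictor {Ω S T : Type} [Fintype Ω] [Fintype S] [Fintype T]
    {μ : Ω → ℝ} (hμ : ∀ ω, 0 ≤ μ ω) (hμ1 : ∑ ω, μ ω = 1) (X : Ω → S) (Y : Ω → T)
    (g : T → S) :
    condEnt μ X Y * Real.log 2 ≤ pmfProb μ {ω | X ω ≠ g (Y ω)} +
      2 * (√(pmfProb μ {ω | X ω ≠ g (Y ω)}) * √(Fintype.card S)) := by
  classical
  rw [condEnt_mul_log_two]
  set w : T → S → ℝ := fun t s => pmfProb μ {ω | X ω = s ∧ Y ω = t} with hw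
  set W : T → ℝ := fun t => pmfProb μ {ω | Y ω = t} with hW
  set P := pmfProb μ {ω | X ω ≠ g (Y ω)} with hP
  have hPeq : P = ∑ t, ∑ s, if s = g t then 0 else w t s := pmfProb_ne_eq μ X Y g
  have hw0 : ∀ t s, 0 ≤ w t s := fun t s => pmfProb_nonneg hμ _
  have hW0 : ∀ t, 0 ≤ W t := fun t => pmfProb_nonneg hμ _
  have hwW : ∀ t s, w t s ≤ W t := fun t s => pmfProb_and_le hμ X Y s t
  have hsum : ∀ t, ∑ s, w t s = W t := sum_pmfProb_and μ X Y
  have hW1 : ∑ t, W t = 1 := (sum_pmfProb μ Y).trans hμ1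
  set v : T → S → ℝ := fun t s => if s = g t then 0 else w t s with hv
  have hv0 : ∀ t s, 0 ≤ v t s := fun t s => by
    simp only [hv]; split_ifs <;> simp [hw0]
  have hdiff : ∀ t, W t - w t (g t) = ∑ s, v t s := by
    intro t
    have : ∀ s, v t s = w t s - if s = g t then w t s else 0 := by
      intro s; simp only [hv]; split_ifs <;> simp
    simp only [this, Finset.sum_sub_distrib, hsum]
    simp
  have hterm : ∀ t s, -w t s * Real.log (w t s / W t) ≤
      (if s = g t then W t - w t (g t) else 0) + 2 * (√(v t s) * √(W t)) := by
    intro t s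
    by_cases h : s = g t
    · simpa [hv, h] using neg_mul_log_div_le_sub (hw0 t (g t)) (hwW t (g t))
    · simpa [hv, h] using neg_mul_log_div_le_sqrt (hw0 t s) (hwW t s)
  have hcs : ∑ t, ∑ s, √(v t s) * √(W t) ≤ √P * √(Fintype.card S) := by
    have := Real.sum_sqrt_mul_sqrt_le (Finset.univ : Finset (T × S))
      (f := fun z => v z.1 z.2) (g := fun z => W z.1) (fun z => hv0 _ _) (fun z => hW0 _)
    simp only [Fintype.sum_prod_type] at this
    refine this.trans (le_of_eq ?_)
    rw [hPeq]
    congr 2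
    simp [← Finset.mul_sum, hW1]
  calc _ ≤ ∑ t, ∑ s, ((if s = g t then W t - w t (g t) else 0) + 2 * (√(v t s) * √(W t))) :=
        Finset.sum_le_sum fun t _ => Finset.sum_le_sum fun s _ => hterm t s
    _ = P + 2 * ∑ t, ∑ s, √(v t s) * √(W t) := by
        simp only [Finset.sum_add_distrib, Finset.mul_sum]
        congr 1
        simp [hPeq, hdiff, hv]
    _ ≤ _ := by gcongr

theorem pmfProb_le_one {Ω : Type} [Fintype Ω] {μ : Ω → ℝ} (hμ : ∀ ω, 0 ≤ μ ω)
    (hμ1 : ∑ ω, μ ω = 1) (E : Set Ω) : pmfProb μ E ≤ 1 := by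
  rw [← hμ1]
  refine Finset.sum_le_sum fun ω _ => ?_
  split_ifs <;> simp [hμ]

open Classical in
theorem pmfProb_forall_eq_prod {Ω S ι : Type} [Fintype Ω] [Fintype S] [Fintype ι] {μ : Ω → ℝ}
    (Z : ι → Ω → S) (p : S → ℝ)
    (hp : ∀ i s, pmfProb μ {ω | Z i ω = s} = p s)
    (hind : ∀ x : ι → S, pmfProb μ {ω | ∀ i, Z i ω = x i} = ∏ i, p (x i))
    (B : ι → S → Prop) :
    pmfProb μ {ω | ∀ i, B i (Z i ω)} = ∏ i, pmfProb μ {ω | B i (Z i ω)} := by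
  have h := pmfProb_comp μ (fun ω i => Z i ω) (fun x => ∀ i, B i (x i))
  rw [h]
  have h1 : ∀ i, pmfProb μ {ω | B i (Z i ω)} = ∑ s, if B i s then p s else 0 := by
    intro i
    rw [pmfProb_comp μ (Z i) (B i)]
    simp only [hp]
  simp only [h1]
  rw [Finset.prod_univ_sum, Fintype.piFinset_univ]
  refine Finset.sum_congr rfl fun x _ => ?_
  simp only [funext_iff, hind]
  split_ifs with hx
  · exact Finset.prod_congr rfl fun i _ => by rw [if_pos (hx i)]
  · push Not at hx
    obtain ⟨i, hi⟩ := hx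
    exact (Finset.prod_eq_zero (Finset.mem_univ i) (if_neg hi)).symm

open Classical in
theorem pmfProb_card_filter_ge_le {Ω S ι : Type} [Fintype Ω] [Fintype S] [Fintype ι] {μ : Ω → ℝ}
    (hμ : ∀ ω, 0 ≤ μ ω) (hμ1 : ∑ ω, μ ω = 1) (Z : ι → Ω → S) (p : S → ℝ)
    (hp : ∀ i s, pmfProb μ {ω | Z i ω = s} = p s)
    (hind : ∀ x : ι → S, pmfProb μ {ω | ∀ i, Z i ω = x i} = ∏ i, p (x i))
    (B : ι → S → Prop) {c : ℝ} (hc : 0 ≤ c) (hB : ∀ i, pmfProb μ {ω | B i (Z i ω)} ≤ c)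
    (t : ℕ) :
    pmfProb μ {ω | t ≤ (Finset.univ.filter fun i => B i (Z i ω)).card}
      ≤ 2 ^ Fintype.card ι * c ^ t := by
  have hT : ∀ T : Finset ι, pmfProb μ {ω | ∀ i, i ∈ T → B i (Z i ω)} ≤ c ^ T.card := by
    intro T
    rw [pmfProb_forall_eq_prod Z p hp hind fun i s => i ∈ T → B i s]
    calc _ ≤ ∏ i, if i ∈ T then c else 1 := by
          refine Finset.prod_le_prod (fun i _ => pmfProb_nonneg hμ _) fun i _ => ?_
          by_cases hi : i ∈ T
          · simpa [hi] using hB i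
          · simpa [hi] using pmfProb_le_one hμ hμ1 _
      _ = c ^ T.card := by simp
  calc _ ≤ pmfProb μ {ω | ∃ T ∈ Finset.univ.powersetCard t,
          ω ∈ {ω | ∀ i, i ∈ T → B i (Z i ω)}} := by
        refine pmfProb_mono hμ fun ω hω => ?_
        obtain ⟨T, hT, hTc⟩ := Finset.exists_subset_card_eq hω
        exact ⟨T, by simp [Finset.mem_powersetCard, hTc],
          fun i hi => (Finset.mem_filter.1 (hT hi)).2⟩
    _ ≤ ∑ T ∈ Finset.univ.powersetCard t, pmfProb μ {ω | ∀ i, i ∈ T → B i (Z i ω)} :=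
        pmfProb_biUnion_le hμ _ _
    _ ≤ ∑ T ∈ (Finset.univ : Finset ι).powersetCard t, c ^ t :=
        Finset.sum_le_sum fun T hT' => by
          simpa [(Finset.mem_powersetCard.1 hT').2] using hT T
    _ ≤ 2 ^ Fintype.card ι * c ^ t := by
        rw [Finset.sum_const, nsmul_eq_mul, Finset.card_powersetCard, Finset.card_univ]
        gcongr
        exact_mod_cast Nat.choose_le_two_pow _ _

/-- If the first `r` columns of `M` are parity checks of a code of distance more than `2 * t`,
then these syndromes determine a vector from any approximation of it within distance `t`. -/
theorem exists_syndrome_decoder {q k r t : ℕ} {Alph : Type} [NeZero q]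
    (M : Matrix (Fin k) (Fin k) (ZMod q))
    (hM : ∀ v : Fin k → ZMod q, (∀ j : Fin k, (j : ℕ) < r → Matrix.vecMul v M j = 0) →
      hammingNorm v ≤ 2 * t → v = 0)
    (guess : Fin k → Alph → ZMod q) (j : Fin k) (hj : r ≤ j) :
    ∃ g : (Fin (j : ℕ) → ZMod q) × (Fin k → Alph) → ZMod q,
      ∀ (u : Fin k → ZMod q) (a : Fin k → Alph),
        hammingDist u (fun i => guess i (a i)) ≤ t →
        Matrix.vecMul u M j
          = g (fun i => Matrix.vecMul u M (Fin.castLE j.isLt.le i), a) := by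
  classical
  refine ⟨fun y => if h : ∃ u : Fin k → ZMod q,
    hammingDist u (fun i => guess i (y.2 i)) ≤ t ∧
      (fun i : Fin (j : ℕ) => Matrix.vecMul u M (Fin.castLE j.isLt.le i)) = y.1
    then Matrix.vecMul h.choose M j else 0, fun u a hu => ?_⟩
  have h : ∃ u' : Fin k → ZMod q, hammingDist u' (fun i => guess i (a i)) ≤ t ∧
      (fun i : Fin (j : ℕ) => Matrix.vecMul u' M (Fin.castLE j.isLt.le i))
        = fun i => Matrix.vecMul u M (Fin.castLE j.isLt.le i) := ⟨u, hu, rfl⟩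
  simp only [dif_pos h]
  obtain ⟨h1, h2⟩ := h.choose_spec
  suffices u - h.choose = 0 by rw [← sub_eq_zero.1 this]
  refine hM _ (fun i hi => ?_) ?_
  · have := congrFun h2 ⟨i, hi.trans_le hj⟩
    rw [Matrix.sub_vecMul, Pi.sub_apply, sub_eq_zero]
    exact this.symm
  · rw [sub_eq_neg_add, ← hammingDist_eq_hammingNorm]
    have := hammingDist_triangle_right h.choose u (fun i => guess i (a i))
    omega

theorem nCondEnt_eq {q : ℕ} [NeZero q] {Ω T : Type} [Fintype Ω] [Fintype T]
    (μ : Ω → ℝ) (X : Ω → ZMod q) (Y : Ω → T) :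
    nCondEnt q μ X Y = condEnt μ X Y * Real.log 2 / Real.log q := by
  rw [nCondEnt, Real.logb, div_div_eq_mul_div]

theorem nCondEnt_le_sqrt {q : ℕ} [NeZero q] (hq : q.Prime) {Ω T : Type} [Fintype Ω] [Fintype T]
    {μ : Ω → ℝ} (hμ : ∀ ω, 0 ≤ μ ω) (hμ1 : ∑ ω, μ ω = 1) (X : Ω → ZMod q) (Y : Ω → T)
    (g : T → ZMod q) :
    nCondEnt q μ X Y ≤ 3 * √q / Real.log q * √(pmfProb μ {ω | X ω ≠ g (Y ω)}) := by
  have hL : 0 < Real.log q := Real.log_pos (by exact_mod_cast hq.one_lt)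
  have h := condEnt_le_of_predictor hμ hμ1 X Y g
  rw [ZMod.card] at h
  set P := pmfProb μ {ω | X ω ≠ g (Y ω)}
  have hP0 : 0 ≤ P := pmfProb_nonneg hμ _
  have hs0 := Real.sqrt_nonneg P
  have hs1 : √P ≤ 1 := Real.sqrt_le_one.2 (pmfProb_le_one hμ hμ1 _)
  have hPs : P ≤ √P := by nlinarith [Real.mul_self_sqrt hP0]
  have hq1 : 1 ≤ √(q : ℝ) := Real.one_le_sqrt.2 (by exact_mod_cast hq.one_lt.le)
  rw [nCondEnt_eq, div_mul_eq_mul_div]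
  refine div_le_div_of_nonneg_right ?_ hL.le
  nlinarith [mul_nonneg hs0 (sub_nonneg.2 hq1)]

theorem expPolar_of_parityCheck {q k r t : ℕ} [NeZero q] (hq : q.Prime)
    (M : Matrix (Fin k) (Fin k) (ZMod q))
    (hM : ∀ v : Fin k → ZMod q, (∀ j : Fin k, (j : ℕ) < r → Matrix.vecMul v M j = 0) →
      hammingNorm v ≤ 2 * t → v = 0)
    {b ε : ℝ} (hb : 0 < b) (ht : 2 * b + 1 ≤ t) (hr : r ≤ ε * k) (hrk : r ≤ k) :
    ExpPolar q k M (1 - ε) b := by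
  classical
  have hL : 0 < Real.log q := Real.log_pos (by exact_mod_cast hq.one_lt)
  have hq0 : (0 : ℝ) < q := by exact_mod_cast hq.pos
  set C : ℝ := 3 * √q / Real.log q * √(2 ^ k * Real.log q ^ t) with hC
  have hC0 : 0 < C := by positivity
  refine ⟨min 1 ((1 / C) ^ 2), by positivity, ?_⟩
  intro δ hδ0 hδ Ω Alph _ _ μ hμ hμ1 U A ⟨p, hp, hind⟩ hU
  have hδ1 : δ ≤ 1 := (hδ.trans_le (min_le_left _ _)).le
  have hsδ : √δ ≤ 1 / C := by
    rw [Real.sqrt_le_left (by positivity)]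
    exact (hδ.trans_le (min_le_right _ _)).le
  choose guess hguess using fun i => exists_predictor hμ (U i) (A i)
  set c := δ * Real.log q with hc
  have hguess' : ∀ i, pmfProb μ {ω | U i ω ≠ guess i (A i ω)} ≤ c := by
    intro i
    refine (hguess i).trans ?_
    have := hU i
    rwa [nCondEnt_eq, div_le_iff₀ hL] at this
  have hbad : pmfProb μ {ω | t ≤ hammingDist (fun i => U i ω) (fun i => guess i (A i ω))}
      ≤ 2 ^ k * c ^ t := by
    have := pmfProb_card_filter_ge_le hμ hμ1 (fun i ω => (U i ω, A i ω)) p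
      (fun i s => by simpa [Prod.ext_iff] using hp i s.1 s.2)
      (fun x => by simpa [Prod.ext_iff] using hind (fun i => (x i).1) (fun i => (x i).2))
      (fun i s => s.1 ≠ guess i s.2) (by positivity) hguess' t
    rw [Fintype.card_fin] at this
    convert this using 5
    unfold hammingDist
    congr
  have hgood : ∀ j : Fin k, r ≤ j →
      nCondEnt q μ (fun ω => Matrix.vecMul (fun i => U i ω) M j)
          (fun ω => ((fun i : Fin (j : ℕ) =>
              Matrix.vecMul (fun i' => U i' ω) M (Fin.castLE j.isLt.le i)),
            (fun i => A i ω))) ≤ δ ^ b := by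
    intro j hj
    obtain ⟨g, hg⟩ := exists_syndrome_decoder M hM guess j hj
    refine (nCondEnt_le_sqrt hq hμ hμ1 _ _ g).trans ?_
    have hP : pmfProb μ {ω | Matrix.vecMul (fun i => U i ω) M j ≠ g ((fun i : Fin (j : ℕ) =>
              Matrix.vecMul (fun i' => U i' ω) M (Fin.castLE j.isLt.le i)),
            (fun i => A i ω))} ≤ 2 ^ k * Real.log q ^ t * (δ ^ b * √δ) ^ 2 := by
      refine (pmfProb_mono hμ fun ω hω => ?_).trans (hbad.trans ?_)
      · by_contra h
        exact hω (hg _ _ (not_le.1 h).le)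
      · have h1 : δ ^ t ≤ (δ ^ b * √δ) ^ 2 := by
          calc δ ^ t = δ ^ (t : ℝ) := (Real.rpow_natCast _ _).symm
            _ ≤ δ ^ (2 * b + 1) :=
              Real.rpow_le_rpow_of_exponent_ge_of_imp hδ0 hδ1 ht fun _ h => by linarith
            _ = δ ^ (b * (2 : ℕ)) * δ := by
              rw [Real.rpow_add_one' hδ0 (by positivity)]
              congr 2
              push_cast
              ring
            _ = (δ ^ b * √δ) ^ 2 := by
              rw [mul_pow, Real.sq_sqrt hδ0, Real.rpow_mul_natCast hδ0]
        rw [hc, mul_pow]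
        nlinarith [mul_le_mul_of_nonneg_left h1 (by positivity : 0 ≤ 2 ^ k * Real.log q ^ t)]
    have hδb : 0 ≤ δ ^ b := Real.rpow_nonneg hδ0 _
    calc _ ≤ 3 * √q / Real.log q * √(2 ^ k * Real.log q ^ t * (δ ^ b * √δ) ^ 2) := by gcongr
      _ = δ ^ b * (C * √δ) := by
        rw [Real.sqrt_mul (by positivity), Real.sqrt_sq (by positivity), hC]
        ring
      _ ≤ δ ^ b * 1 := by
        gcongr
        rwa [le_div_iff₀' hC0] at hsδ
      _ = δ ^ b := mul_one _
  calc (1 - ε) * k ≤ ((k - r : ℕ) : ℝ) := by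
        rw [Nat.cast_sub hrk]; linarith
    _ ≤ _ := by
        norm_cast
        calc k - r = ((Finset.univ : Finset (Fin k)).filter fun j : Fin k => r ≤ (j : ℕ)).card := by
              have h1 := Finset.card_filter_add_card_filter_not
                (s := (Finset.univ : Finset (Fin k))) (p := fun j : Fin k => (j : ℕ) < r)
              have h2 := Fin.card_filter_val_lt (n := k) (m := r)
              simp only [not_lt] at h1
              rw [Finset.card_univ, Fintype.card_fin] at h1
              omega
          _ ≤ _ := Finset.card_le_card fun j hj => by
              simp only [Finset.mem_filter, Finset.mem_univ, true_and] at hj ⊢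
              exact hgood j hj

/-- The Reed–Solomon parity checks over `𝔽_{q^m}`, restricted to vectors over `𝔽_q`. -/
theorem exists_bch_parityCheck (q m D : ℕ) [Fact q.Prime] (hm : m ≠ 0) :
    ∃ T : (Fin (q ^ m) → ZMod q) →ₗ[ZMod q] (Fin D → GaloisField q m),
      ∀ v, T v = 0 → hammingNorm v ≤ D → v = 0 := by
  classical
  let e : Fin (q ^ m) ≃ GaloisField q m :=
    (Finite.equivFinOfCardEq (GaloisField.card q m hm)).symm
  refine ⟨LinearMap.pi fun i =>
    Fintype.linearCombination (ZMod q) fun x => e x ^ (i : ℕ), fun v hv hw => ?_⟩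
  let s : Finset (Fin (q ^ m)) := Finset.univ.filter fun x => v x ≠ 0
  have hs : s.card ≤ D := hw
  let f := s.equivFin
  have hf : (fun i : Fin s.card => algebraMap (ZMod q) (GaloisField q m) (v (f.symm i))) = 0 := by
    refine Matrix.eq_zero_of_forall_pow_sum_mul_pow_eq_zero (f := fun i => e (f.symm i))
      (fun i j h => f.symm.injective (Subtype.ext (e.injective h))) fun i => ?_
    have h := congrFun hv ⟨i, i.isLt.trans_le hs⟩
    simp only [LinearMap.pi_apply, Fintype.linearCombination_apply, Pi.zero_apply,
      Algebra.smul_def] at h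
    rw [← h, Equiv.sum_comp f.symm fun x : s =>
      algebraMap (ZMod q) (GaloisField q m) (v x) * e x ^ (i : ℕ),
      Finset.sum_coe_sort s fun x => algebraMap (ZMod q) (GaloisField q m) (v x) * e x ^ (i : ℕ)]
    refine Finset.sum_subset (Finset.subset_univ _) fun x _ hx => ?_
    have : v x = 0 := by simpa [s] using hx
    simp [this]
  funext x
  by_contra hx
  have hxs : x ∈ s := by simpa [s] using hx
  have h := congrFun hf (f ⟨x, hxs⟩)
  simp only [Equiv.symm_apply_apply, Pi.zero_apply, map_eq_zero] at h
  exact hx h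

/-- Any linear map can be checked to vanish by the leading coordinates of an invertible matrix,
using as many of them as its rank. -/
theorem exists_matrix_ker_le {K W : Type*} [Field K] [AddCommGroup W] [Module K W] {k : ℕ}
    (T : (Fin k → K) →ₗ[K] W) :
    ∃ M : Matrix (Fin k) (Fin k) K, IsUnit M.det ∧ ∀ v : Fin k → K,
      (∀ j : Fin k, (j : ℕ) < Module.finrank K (LinearMap.range T) → Matrix.vecMul v M j = 0) →
        T v = 0 := by
  obtain ⟨V, hV⟩ := Submodule.exists_isCompl (LinearMap.ker T)
  let φ := Submodule.prodEquivOfIsCompl V (LinearMap.ker T) hV.symm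
  have hdim : Module.finrank K V + Module.finrank K (LinearMap.ker T) = k := by
    rw [Submodule.finrank_add_eq_of_isCompl hV.symm, Module.finrank_fin_fun]
  have hrank : Module.finrank K (LinearMap.range T) = Module.finrank K V := by
    have := T.finrank_range_add_finrank_ker
    rw [Module.finrank_fin_fun] at this
    omega
  let b : Module.Basis (Fin k) K (Fin k → K) :=
    (((Module.finBasis K V).prod (Module.finBasis K (LinearMap.ker T))).map φ).reindex
      (finSumFinEquiv.trans (finCongr hdim))
  refine ⟨(LinearMap.toMatrix' b.equivFun.toLinearMap).transpose, ?_, fun v hv => ?_⟩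
  · rw [Matrix.det_transpose, LinearMap.det_toMatrix']
    exact LinearEquiv.isUnit_det' _
  · simp only [Matrix.vecMul_transpose, LinearMap.toMatrix'_mulVec, LinearEquiv.coe_coe,
      Module.Basis.equivFun_apply] at hv
    have h0 : (φ.symm v).1 = 0 := by
      refine (Module.finBasis K V).ext_elem fun i => ?_
      have h := hv (finCongr hdim (Fin.castAdd _ i)) (by simp [hrank])
      rw [Module.Basis.repr_reindex_apply] at h
      simpa [b] using h
    have h1 : v = φ (0, (φ.symm v).2) := by
      rw [← h0]; simp
    have h2 : φ (0, (φ.symm v).2) = ((φ.symm v).2 : Fin k → K) := by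
      simp [φ]
    rw [h1, h2]
    exact (φ.symm v).2.2

theorem isMixing_of_parityCheck {q k r : ℕ} [Fact q.Prime] (M : Matrix (Fin k) (Fin k) (ZMod q))
    (hdet : IsUnit M.det) (hrk : r < k)
    (hM : ∀ v : Fin k → ZMod q, (∀ j : Fin k, (j : ℕ) < r → Matrix.vecMul v M j = 0) →
      hammingNorm v ≤ 1 → v = 0) :
    IsMixing M := by
  refine ⟨hdet, fun σ hσ => ?_⟩
  have hk : k - 1 < k := by omega
  have h := hM (Pi.single (σ ⟨k - 1, hk⟩) 1) (fun j hj => ?_) ?_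
  · simpa using congrFun h (σ ⟨k - 1, hk⟩)
  · rw [Matrix.single_one_vecMul]
    exact hσ _ _ (Fin.lt_def.2 (by simp; omega))
  · rw [hammingNorm, Finset.card_le_one]
    simp only [Finset.mem_filter, Finset.mem_univ, true_and, Pi.single_apply]
    grind

theorem exists_exponent (q : ℕ) (hq : 1 < q) {ε : ℝ} (hε : 0 < ε) (hε1 : ε < 1) :
    ∃ m t : ℕ, m ≠ 0 ∧ 2 * ((q ^ m : ℕ) : ℝ) ^ (1 - ε) + 1 ≤ t ∧
      ((2 * t * m : ℕ) : ℝ) ≤ ε * (q ^ m : ℕ) := by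
  have hq1 : (1 : ℝ) < q := by exact_mod_cast hq
  have h := tendsto_pow_const_div_const_pow_of_one_lt 1 (Real.one_lt_rpow hq1 hε)
  obtain ⟨m, hm, hm1⟩ := ((h.eventually_lt_const (by positivity : 0 < ε / 8)).and
    (Filter.eventually_ge_atTop 1)).exists
  set k : ℝ := ((q ^ m : ℕ) : ℝ) with hk
  have hk1 : 1 ≤ k := by rw [hk]; exact_mod_cast Nat.one_le_pow _ _ (by omega)
  set b := k ^ (1 - ε) with hb
  have hb1 : 1 ≤ b := Real.one_le_rpow hk1 (by linarith)
  have hkε : ((q : ℝ) ^ ε) ^ m = k ^ ε := by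
    rw [hk, Nat.cast_pow, ← Real.rpow_mul_natCast (by positivity), mul_comm,
      Real.rpow_natCast_mul (by positivity)]
  have hbk : b * k ^ ε = k := by
    rw [hb, ← Real.rpow_add (by linarith)]
    simp
  refine ⟨m, ⌈2 * b⌉₊ + 1, by omega, ?_, ?_⟩
  · rw [← hk, ← hb, Nat.cast_add_one]
    linarith [Nat.le_ceil (2 * b)]
  · have hc := Nat.ceil_lt_add_one (by positivity : 0 ≤ 2 * b)
    have hkε0 : 0 < k ^ ε := by positivity
    rw [hkε, pow_one, div_lt_iff₀ hkε0] at hm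
    have hb8 : 2 * ((⌈2 * b⌉₊ : ℝ) + 1) ≤ 8 * b := by linarith
    rw [← hk]
    calc ((2 * (⌈2 * b⌉₊ + 1) * m : ℕ) : ℝ) = 2 * ((⌈2 * b⌉₊ : ℝ) + 1) * m := by push_cast; ring
      _ ≤ 8 * b * m := by gcongr
      _ ≤ 8 * b * (ε / 8 * k ^ ε) := by gcongr
      _ = ε * (b * k ^ ε) := by ring
      _ = ε * k := by rw [hbk]

theorem ExpPolar.mono {q k : ℕ} [NeZero q] {M : Matrix (Fin k) (Fin k) (ZMod q)}
    {η η' b b' : ℝ} (h : ExpPolar q k M η b) (hη : η' ≤ η) (hb : b' ≤ b) (hb' : 0 < b') :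
    ExpPolar q k M η' b' := by
  obtain ⟨τ, hτ, H⟩ := h
  refine ⟨min τ 1, by positivity, ?_⟩
  intro δ hδ0 hδ Ω Alph _ _ μ hμ hμ1 U A hp hU
  have hδb : δ ^ b ≤ δ ^ b' :=
    Real.rpow_le_rpow_of_exponent_ge_of_imp hδ0 (hδ.trans_le (min_le_right _ _)).le hb
      fun _ h => absurd h (hb'.trans_le hb).ne'
  refine le_trans (by gcongr) ((H δ hδ0 (hδ.trans_le (min_le_left _ _)) Ω Alph μ hμ hμ1 U A hp
    hU).trans ?_)
  norm_cast
  exact Finset.card_le_card fun j hj => by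
    simp only [Finset.mem_filter, Finset.mem_univ, true_and] at hj ⊢
    exact hj.trans hδb

theorem exists_mixing_expPolar_of_lt_one (q : ℕ) [NeZero q] (hq : Nat.Prime q) {ε : ℝ}
    (hε : 0 < ε) (hε1 : ε < 1) :
    ∃ (k : ℕ) (M : Matrix (Fin k) (Fin k) (ZMod q)), 0 < k ∧ IsMixing M ∧
      ExpPolar q k M (1 - ε) ((k : ℝ) ^ ((1 : ℝ) - ε)) := by
  have : Fact q.Prime := ⟨hq⟩
  obtain ⟨m, t, hm, ht, htm⟩ := exists_exponent q hq.one_lt hε hε1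
  obtain ⟨T, hT⟩ := exists_bch_parityCheck q m (2 * t) hm
  obtain ⟨M, hdet, hM⟩ := exists_matrix_ker_le T
  have hk : 0 < q ^ m := pow_pos hq.pos m
  have hr : Module.finrank (ZMod q) (LinearMap.range T) ≤ 2 * t * m := by
    refine (Submodule.finrank_le _).trans_eq ?_
    rw [Module.finrank_pi_fintype]
    simp [GaloisField.finrank q hm]
  have hrε : (Module.finrank (ZMod q) (LinearMap.range T) : ℝ) ≤ ε * (q ^ m : ℕ) :=
    le_trans (by exact_mod_cast hr) htm
  have hk' : (0 : ℝ) < (q ^ m : ℕ) := by exact_mod_cast hk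
  have hrk : Module.finrank (ZMod q) (LinearMap.range T) < q ^ m := by
    have : (Module.finrank (ZMod q) (LinearMap.range T) : ℝ) < (q ^ m : ℕ) := by nlinarith
    exact_mod_cast this
  have hb : 0 < ((q ^ m : ℕ) : ℝ) ^ (1 - ε) := by positivity
  have ht1 : 1 ≤ t := by
    have : (0 : ℝ) < t := by linarith
    exact_mod_cast this
  exact ⟨q ^ m, M, hk,
    isMixing_of_parityCheck M hdet hrk fun v hv hw => hT v (hM v hv) (by omega),
    expPolar_of_parityCheck hq M (fun v hv => hT v (hM v hv)) hb ht hrε hrk.le⟩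

/-- for every `ε > 0` and prime `q` there are `k` and a mixing matrix
`M ∈ 𝔽_q^{k×k}` satisfying `(1-ε, k^{1-ε})`-exponential polarization. -/
theorem stmt11 (q : ℕ) [NeZero q] (hq : Nat.Prime q) (ε : ℝ) (hε : 0 < ε) :
    ∃ (k : ℕ) (M : Matrix (Fin k) (Fin k) (ZMod q)), 0 < k ∧ IsMixing M ∧
      ExpPolar q k M (1 - ε) ((k : ℝ) ^ ((1 : ℝ) - ε)) := by
  obtain ⟨k, M, hk, hM, hP⟩ := exists_mixing_expPolar_of_lt_one q hq
    (lt_min hε one_half_pos) ((min_le_right ε (1 / 2)).trans_lt one_half_lt_one)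
  have hk1 : (1 : ℝ) ≤ k := by exact_mod_cast hk
  have hε' := min_le_left ε (1 / 2)
  exact ⟨k, M, hk, hM, hP.mono (by linarith)
    (Real.rpow_le_rpow_of_exponent_le hk1 (by linarith)) (by positivity)⟩
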